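/- Let G be the DAG on the node set {1, 2, 3, 4} with arcs 1 → 3, 2 → 4, 3 → 4, and let W be the grouping V1 = {1}, V2 = {2}, V3 = {3, 4}. Then there is no group DAG H on the three groups {V1, V2, V3} that is groupwise Markov equivalent to G given W. (Concretely: the groupwise d-separation statements of G given W are exactly that V1 and V2 are d-separated by the empty set and by V3, while every other pair of groups is d-connected given each admissible conditioning set, and no DAG on three nodes realizes exactly this pattern of d-separations.) Hence DAGs are not closed under aggregation into variable groups. -/

import Mathlib

open scoped Classical

namespace GroupBN

variable {V : Type*} {I : Type*}

/-- `u` and `v` are adjacent in the digraph with arc relation `A`. -/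
def Adj (A : V → V → Prop) (u v : V) : Prop := A u v ∨ A v u

/-- `A` is the arc relation of a DAG: there are no directed cycles
(in particular `A` is irreflexive). -/
def IsDAG (A : V → V → Prop) : Prop := ∀ v : V, ¬ Relation.TransGen A v v

/-- `u` is an ancestor of `v`: there is a nonempty directed path from `u` to `v`. -/
def Ancestor (A : V → V → Prop) (u v : V) : Prop := Relation.TransGen A u v

/-- `u` and `v` are d-connected given `Z`: there is a path (an injective sequence of
pairwise adjacent consecutive nodes) from `u` to `v` such that every head-to-head
interior node is in `Z` or has a descendant in `Z`, and no other interior node is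
in `Z`. -/
def DConn (A : V → V → Prop) (Z : Set V) (u v : V) : Prop :=
  ∃ (n : ℕ) (pth : Fin (n + 2) → V),
    Function.Injective pth ∧
    pth 0 = u ∧ pth (Fin.last (n + 1)) = v ∧
    (∀ (k : ℕ) (h : k + 1 < n + 2),
      Adj A (pth ⟨k, Nat.lt_of_succ_lt h⟩) (pth ⟨k + 1, h⟩)) ∧
    (∀ (k : ℕ) (h : k + 2 < n + 2),
      (A (pth ⟨k, by omega⟩) (pth ⟨k + 1, by omega⟩) ∧
         A (pth ⟨k + 2, h⟩) (pth ⟨k + 1, by omega⟩) →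
        (pth ⟨k + 1, by omega⟩ ∈ Z ∨ ∃ d ∈ Z, Ancestor A (pth ⟨k + 1, by omega⟩) d)) ∧
      (¬ (A (pth ⟨k, by omega⟩) (pth ⟨k + 1, by omega⟩) ∧
            A (pth ⟨k + 2, h⟩) (pth ⟨k + 1, by omega⟩)) →
        pth ⟨k + 1, by omega⟩ ∉ Z))

/-- `u` and `v` are d-separated by `Z`. -/
def DSep (A : V → V → Prop) (Z : Set V) (u v : V) : Prop := ¬ DConn A Z u v

/-- The node sets `X` and `Y` are d-separated by `Z`. -/
def DSepSet (A : V → V → Prop) (Z X Y : Set V) : Prop :=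
  ∀ x ∈ X, ∀ y ∈ Y, DSep A Z x y

variable {S : V → Type*}

/-- `p` is a probability mass function on the joint state space. -/
def IsDist [Fintype V] [DecidableEq V] [∀ v, Fintype (S v)]
    (p : (∀ v, S v) → ℝ) : Prop :=
  (∀ f, 0 ≤ p f) ∧ ∑ f, p f = 1

/-- Marginal probability, under `p`, of the event that the variables in `X` take
the values prescribed by the assignment `a`. -/
noncomputable def margin [Fintype V] [DecidableEq V] [∀ v, Fintype (S v)]
    (p : (∀ v, S v) → ℝ) (X : Set V) (a : ∀ v, S v) : ℝ :=
  ∑ f : ∀ v, S v, if ∀ v ∈ X, f v = a v then p f else 0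

/-- Conditional independence `X ⊥ Y | Z` in `p`, in cross-multiplied form:
for every assignment whose `Z`-part has positive probability,
`P(X,Y,Z) · P(Z) = P(X,Z) · P(Y,Z)`. -/
def CondIndep [Fintype V] [DecidableEq V] [∀ v, Fintype (S v)]
    (p : (∀ v, S v) → ℝ) (X Y Z : Set V) : Prop :=
  ∀ a : ∀ v, S v, 0 < margin p Z a →
    margin p (X ∪ Y ∪ Z) a * margin p Z a = margin p (X ∪ Z) a * margin p (Y ∪ Z) a

/-- `p` is faithful to the DAG `A`: conditional independence coincides with
d-separation for all pairwise disjoint `X`, `Y`, `Z` with `X`, `Y` nonempty. -/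
def Faithful [Fintype V] [DecidableEq V] [∀ v, Fintype (S v)]
    (p : (∀ v, S v) → ℝ) (A : V → V → Prop) : Prop :=
  ∀ X Y Z : Set V, X.Nonempty → Y.Nonempty →
    Disjoint X Y → Disjoint X Z → Disjoint Y Z →
    (CondIndep p X Y Z ↔ DSepSet A Z X Y)

/-- `p` is groupwise faithful to the group DAG `H` given the grouping whose groups
are the fibers of the surjection `π`. -/
def GroupwiseFaithful [Fintype V] [DecidableEq V] [∀ v, Fintype (S v)]
    (p : (∀ v, S v) → ℝ) (π : V → I) (H : I → I → Prop) : Prop :=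
  ∀ i j : I, i ≠ j → ∀ T : Set I, i ∉ T → j ∉ T →
    (CondIndep p (π ⁻¹' {i}) (π ⁻¹' {j}) (π ⁻¹' T) ↔ DSep H T i j)

/-- The variable DAG `A` is groupwise Markov equivalent to the group DAG `H`
given the grouping whose groups are the fibers of the surjection `π`. -/
def GroupwiseMarkovEquiv (A : V → V → Prop) (π : V → I) (H : I → I → Prop) : Prop :=
  ∀ i j : I, i ≠ j → ∀ T : Set I, i ∉ T → j ∉ T →
    (DSepSet A (π ⁻¹' T) (π ⁻¹' {i}) (π ⁻¹' {j}) ↔ DSep H T i j)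

/-- Adjacent distinct nodes are d-connected given any set. -/
theorem DConn.of_adj {A : V → V → Prop} {u v : V} (Z : Set V) (huv : u ≠ v)
    (h : Adj A u v) : DConn A Z u v := by
  refine ⟨0, ![u, v], ?_, rfl, rfl, ?_, ?_⟩
  · intro i j hij
    fin_cases i <;> fin_cases j <;> simp_all
  · intro k hk
    obtain rfl : k = 0 := by omega
    exact h
  · intro k hk
    omega

/-- The first node of a d-connecting path is adjacent to some other node. -/
theorem DConn.exists_adj {A : V → V → Prop} {Z : Set V} {u v : V} (h : DConn A Z u v) :
    ∃ w, w ≠ u ∧ Adj A u w := by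
  obtain ⟨n, pth, hinj, rfl, -, hadj, -⟩ := h
  refine ⟨pth ⟨1, by omega⟩, fun he => ?_, hadj 0 (by omega)⟩
  simpa [Fin.ext_iff] using hinj he

/-- The endpoints of a path `u, w, v` are d-connected given the empty set or given `{w}`,
according to whether `w` is a head-to-head node. -/
theorem DConn.of_adj_of_adj {A : V → V → Prop} {u w v : V} (huw : u ≠ w) (hwv : w ≠ v)
    (huv : u ≠ v) (h₁ : Adj A u w) (h₂ : Adj A w v) :
    DConn A ∅ u v ∨ DConn A {w} u v := by
  have hinj : Function.Injective ![u, w, v] := by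
    intro i j hij
    fin_cases i <;> fin_cases j <;> simp_all [eq_comm]
  have hadj : ∀ (k : ℕ) (h : k + 1 < 1 + 2),
      Adj A (![u, w, v] ⟨k, Nat.lt_of_succ_lt h⟩) (![u, w, v] ⟨k + 1, h⟩) := by
    intro k hk
    obtain rfl | rfl : k = 0 ∨ k = 1 := by omega
    exacts [h₁, h₂]
  by_cases hc : A u w ∧ A v w
  · refine Or.inr ⟨1, ![u, w, v], hinj, rfl, rfl, hadj, fun k hk => ?_⟩
    obtain rfl : k = 0 := by omega
    exact ⟨fun _ => Or.inl rfl, fun hn => absurd hc hn⟩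
  · refine Or.inl ⟨1, ![u, w, v], hinj, rfl, rfl, hadj, fun k hk => ?_⟩
    obtain rfl : k = 0 := by omega
    exact ⟨fun h => absurd h hc, fun _ => id⟩

/-- In the DAG `0 → 2 → 3 ← 1`, a set d-connecting `0` and `1` avoids `2` and is nonempty. -/
theorem DConn.not_mem_and_nonempty {Z : Set (Fin 4)}
    (h : DConn (fun u v : Fin 4 =>
      (u = 0 ∧ v = 2) ∨ (u = 1 ∧ v = 3) ∨ (u = 2 ∧ v = 3)) Z 0 1) :
    2 ∉ Z ∧ Z.Nonempty := by
  obtain ⟨n, pth, hinj, h0, hlast, hadj, hmid⟩ := h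
  have e0 : pth ⟨0, by omega⟩ = 0 := h0
  have e1 : pth ⟨1, by omega⟩ = 2 := by
    have := hadj 0 (by omega)
    simp only [Adj, e0] at this
    grind
  have hn : 0 < n := by
    rcases Nat.eq_zero_or_pos n with rfl | hn
    · exact absurd (hlast.symm.trans e1) (by decide)
    · exact hn
  have e2 : pth ⟨2, by omega⟩ = 3 := by
    have := hadj 1 (by omega)
    have hne : pth ⟨2, by omega⟩ ≠ pth ⟨0, by omega⟩ := fun he => by
      simpa [Fin.ext_iff] using hinj he
    simp only [Adj, e1] at this
    grind
  have hn' : 1 < n := by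
    rcases Nat.lt_or_ge 1 n with hn' | hn'
    · exact hn'
    · obtain rfl : n = 1 := by omega
      exact absurd (hlast.symm.trans e2) (by decide)
  have e3 : pth ⟨3, by omega⟩ = 1 := by
    have := hadj 2 (by omega)
    have hne : pth ⟨3, by omega⟩ ≠ pth ⟨1, by omega⟩ := fun he => by
      simpa [Fin.ext_iff] using hinj he
    simp only [Adj, e2] at this
    grind
  constructor
  · have := (hmid 0 (by omega)).2
    simp only [Nat.zero_add, e0, e1, e2] at this
    exact this (by decide)
  · have := (hmid 1 (by omega)).1
    simp only [Nat.reduceAdd, e1, e2, e3] at this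
    rcases this (by decide) with hz | ⟨d, hd, -⟩
    exacts [⟨_, hz⟩, ⟨d, hd⟩]

/-- the example of Figure 1(a) of the paper: DAGs are not closed
under aggregation. For the DAG on `{0, 1, 2, 3}` with arcs `0 → 2`, `1 → 3`,
`2 → 3` and the grouping `V₁ = {0}`, `V₂ = {1}`, `V₃ = {2, 3}` (encoded by the
surjection `![0, 1, 2, 2]`), there is no group DAG on the three groups that is
groupwise Markov equivalent to the variable DAG given this grouping. -/
theorem no_group_dag_for_aggregation_example :
    ¬ ∃ H : Fin 3 → Fin 3 → Prop, IsDAG H ∧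
      GroupwiseMarkovEquiv
        (fun u v : Fin 4 =>
          (u = 0 ∧ v = 2) ∨ (u = 1 ∧ v = 3) ∨ (u = 2 ∧ v = 3))
        (![0, 1, 2, 2] : Fin 4 → Fin 3) H := by
  rintro ⟨H, -, hH⟩
  have sep : ∀ T : Set (Fin 3), 0 ∉ T → 1 ∉ T → (2 ∈ T ∨ T = ∅) → DSep H T 0 1 := by
    intro T h0 h1 hT
    refine (hH 0 1 (by decide) T h0 h1).1 fun x hx y hy hc => ?_
    obtain rfl : x = 0 := by
      revert hx; fin_cases x <;> simp
    obtain rfl : y = 1 := by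
      revert hy; fin_cases y <;> simp
    obtain ⟨h2, z, hz⟩ := hc.not_mem_and_nonempty
    rcases hT with hT | rfl
    exacts [h2 hT, hz]
  have conn : ∀ i j : Fin 3, i ≠ j → (i = 0 ∨ i = 1) → j = 2 → DConn H ∅ i j := by
    rintro i j hij hi rfl
    by_contra hc
    have hs := (hH i 2 hij ∅ id id).2 hc
    rcases hi with rfl | rfl
    · exact hs 0 rfl 2 rfl (.of_adj _ (by decide) (Or.inl (by decide)))
    · exact hs 1 rfl 3 rfl (.of_adj _ (by decide) (Or.inl (by decide)))
  have nadj : ¬ Adj H 0 1 := fun h =>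
    sep ∅ id id (Or.inr rfl) (.of_adj _ (by decide) h)
  have adj02 : Adj H 0 2 := by
    obtain ⟨w, hw, h⟩ := (conn 0 2 (by decide) (Or.inl rfl) rfl).exists_adj
    fin_cases w
    exacts [absurd rfl hw, absurd h nadj, h]
  have adj21 : Adj H 2 1 := by
    obtain ⟨w, hw, h⟩ := (conn 1 2 (by decide) (Or.inr rfl) rfl).exists_adj
    fin_cases w
    exacts [absurd h.symm nadj, absurd rfl hw, h.symm]
  rcases DConn.of_adj_of_adj (by decide) (by decide) (by decide) adj02 adj21 with h | h
  · exact sep ∅ id id (Or.inr rfl) h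
  · exact sep {2} (by simp) (by simp) (Or.inl rfl) h

end GroupBN
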